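/- Under the setting of the adversarial randomized Kaczmarz iteration — A ∈ ℝ^{d₁×d₂} with d₁ ≥ d₂, all rows nonzero, σ_min(A) > 0, α = 1 − σ_min(A)²/‖A‖_F², A x* = b, category probabilities q_0, ..., q_k ≥ 0 summing to 1 with error-free category e_0 = 0, error vectors e_1, ..., e_k ∈ ℝ^{d₁}, and iterates x_{i+1} = x_i + ((b_j − ⟨A_j, x_i⟩ + e_ℓ(j))/‖A_j‖²) A_jᵀ with row j drawn with probability ‖A_j‖²/‖A‖_F² and category ℓ with probability q_ℓ, independently at each step — if additionally ‖e_ℓ‖² ≤ C for every ℓ = 1, ..., k, then for every i ≥ 0, 𝔼‖x_{i+1} − x*‖² ≤ α^{i+1} ‖x_0 − x*‖² + ((1 − α^{i+1})/(1 − α)) · C (1 − q_0)/‖A‖_F². -/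

import Mathlib

open Finset
open scoped RealInnerProductSpace

/-- The random sequence of iterates: `iterSeq upd x0 i ω` is the result of applying the
update map `upd` successively with the draws `ω 0, ω 1, …, ω (i-1)`, starting from `x0`;
i.e. `x_i` as a function of the first `i` i.i.d. draws. -/
def iterSeq {σ E : Type*} (upd : σ → E → E) (x0 : E) : (i : ℕ) → (Fin i → σ) → E
  | 0, _ => x0
  | i + 1, ω => upd (ω (Fin.last i)) (iterSeq upd x0 i fun t => ω t.castSucc)

/-- A sum over draws of length `n + 1` splits off the last draw. -/
theorem sum_fin_succ_pi_eq_sum_snoc {σ M : Type*} [Fintype σ] [AddCommMonoid M] (n : ℕ)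
    (F : (Fin (n + 1) → σ) → M) :
    ∑ ω, F ω = ∑ ω : Fin n → σ, ∑ s, F (Fin.snoc (α := fun _ => σ) ω s) := by
  rw [← (Fin.snocEquiv fun _ : Fin (n + 1) => σ).sum_comp, Fintype.sum_prod_type, Finset.sum_comm]
  rfl

/-- If one random update contracts `f` in expectation by the factor `a` up to an additive `B`,
then `n` independent updates satisfy the corresponding geometric bound. -/
theorem sum_prod_mul_iterSeq_le {σ E : Type*} [Fintype σ] (w : σ → ℝ) (hw : ∀ s, 0 ≤ w s)
    (hw1 : ∑ s, w s = 1) (upd : σ → E → E) (f : E → ℝ) {a B : ℝ} (ha : 0 ≤ a)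
    (hstep : ∀ y, ∑ s, w s * f (upd s y) ≤ a * f y + B) (x0 : E) (n : ℕ) :
    ∑ ω : Fin n → σ, (∏ t, w (ω t)) * f (iterSeq upd x0 n ω)
      ≤ a ^ n * f x0 + (∑ m ∈ range n, a ^ m) * B := by
  induction n with
  | zero => simp [iterSeq]
  | succ n ih =>
    have hprod : ∑ ω : Fin n → σ, ∏ t, w (ω t) = 1 := by
      have h := Finset.sum_prod_piFinset (univ : Finset σ) fun (_ : Fin n) => w
      simpa [hw1] using h
    calc ∑ ω : Fin (n + 1) → σ, (∏ t, w (ω t)) * f (iterSeq upd x0 (n + 1) ω)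
        = ∑ ω : Fin n → σ, (∏ t, w (ω t)) * ∑ s, w s * f (upd s (iterSeq upd x0 n ω)) := by
          rw [sum_fin_succ_pi_eq_sum_snoc]
          simp [iterSeq, Fin.prod_univ_castSucc, Finset.mul_sum, mul_assoc]
      _ ≤ ∑ ω : Fin n → σ, (∏ t, w (ω t)) * (a * f (iterSeq upd x0 n ω) + B) := by
          gcongr with ω
          · exact prod_nonneg fun t _ => hw _
          · exact hstep _
      _ = a * ∑ ω : Fin n → σ, (∏ t, w (ω t)) * f (iterSeq upd x0 n ω) + B := by
          simp only [mul_add, sum_add_distrib, ← sum_mul, hprod, one_mul, mul_sum]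
          congr 1
          exact sum_congr rfl fun _ _ => by ring
      _ ≤ a * (a ^ n * f x0 + (∑ m ∈ range n, a ^ m) * B) + B := by gcongr
      _ = a ^ (n + 1) * f x0 + (∑ m ∈ range (n + 1), a ^ m) * B := by
          rw [geom_sum_succ]
          ring

/-- The squared error after a Kaczmarz projection onto a hyperplane with offset error `ε`. -/
theorem norm_sq_kaczmarz_step {E : Type*} [NormedAddCommGroup E] [InnerProductSpace ℝ E]
    {u : E} (hu : u ≠ 0) (y x : E) (ε : ℝ) :
    ‖y + ((⟪u, x⟫ - ⟪u, y⟫ + ε) / ‖u‖ ^ 2) • u - x‖ ^ 2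
      = ‖y - x‖ ^ 2 + (ε ^ 2 - ⟪u, y - x⟫ ^ 2) / ‖u‖ ^ 2 := by
  have hu' : ‖u‖ ≠ 0 := norm_ne_zero_iff.mpr hu
  rw [add_sub_right_comm, norm_add_sq_real, real_inner_smul_right, norm_smul, mul_pow,
    Real.norm_eq_abs, sq_abs, real_inner_comm u (y - x), inner_sub_right]
  field_simp
  ring

/-- Under the setting of the adversarial randomized Kaczmarz iteration —
`A ∈ ℝ^{d₁×d₂}` with `d₁ ≥ d₂`, all rows nonzero, `σ > 0` with
`σ² ‖v‖² ≤ ∑_j ⟪A_j, v⟫² = ‖A v‖²` for all `v`, `α = 1 - σ²/‖A‖_F² ∈ [0,1)`, `A x* = b`,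
category probabilities `q_0, …, q_k ≥ 0` summing to `1` with error-free category
`e_0 = 0`, error vectors `e_1, …, e_k ∈ ℝ^{d₁}`, and the iterates
`x_{i+1} = x_i + ((b_j - ⟪A_j, x_i⟫ + e_ℓ(j))/‖A_j‖²) A_jᵀ` with `(j, ℓ)` drawn i.i.d.
with `ℙ(j) = ‖A_j‖²/‖A‖_F²` and `ℙ(ℓ) = q_ℓ` — if additionally `‖e_ℓ‖² ≤ C` for every
`ℓ = 1, …, k`, then for every `i ≥ 0`,
`𝔼‖x_{i+1} - x*‖² ≤ α^{i+1} ‖x_0 - x*‖² + ((1 - α^{i+1})/(1 - α)) C (1 - q_0)/‖A‖_F²`. -/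
theorem adversarial_kaczmarz_convergence_bounded_noise
    (d₁ d₂ k : ℕ) (hd : d₂ ≤ d₁)
    (A : Fin d₁ → EuclideanSpace ℝ (Fin d₂)) (b : Fin d₁ → ℝ)
    (xstar x0 : EuclideanSpace ℝ (Fin d₂)) (σ : ℝ)
    (hA : ∀ j, A j ≠ 0) (hσpos : 0 < σ)
    (hσ : ∀ v : EuclideanSpace ℝ (Fin d₂), σ ^ 2 * ‖v‖ ^ 2 ≤ ∑ j, ⟪A j, v⟫ ^ 2)
    (hα0 : 0 ≤ 1 - σ ^ 2 / ∑ j, ‖A j‖ ^ 2)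
    (hsol : ∀ j, ⟪A j, xstar⟫ = b j)
    (q : Fin (k + 1) → ℝ) (hq : ∀ ℓ, 0 ≤ q ℓ) (hq1 : ∑ ℓ, q ℓ = 1)
    (e : Fin (k + 1) → Fin d₁ → ℝ) (he0 : e 0 = 0)
    (C : ℝ) (hC : ∀ ℓ : Fin (k + 1), ℓ ≠ 0 → ∑ j, e ℓ j ^ 2 ≤ C)
    (i : ℕ) :
    ∑ ω : Fin (i + 1) → Fin d₁ × Fin (k + 1),
        (∏ t, (‖A (ω t).1‖ ^ 2 / ∑ j, ‖A j‖ ^ 2) * q (ω t).2) *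
          ‖iterSeq
              (fun s y => y + ((b s.1 - ⟪A s.1, y⟫ + e s.2 s.1) / ‖A s.1‖ ^ 2) • A s.1)
              x0 (i + 1) ω - xstar‖ ^ 2
      ≤ (1 - σ ^ 2 / ∑ j, ‖A j‖ ^ 2) ^ (i + 1) * ‖x0 - xstar‖ ^ 2
        + ((1 - (1 - σ ^ 2 / ∑ j, ‖A j‖ ^ 2) ^ (i + 1)) /
              (1 - (1 - σ ^ 2 / ∑ j, ‖A j‖ ^ 2))) *
            (C * (1 - q 0) / ∑ j, ‖A j‖ ^ 2) := by
  rcases isEmpty_or_nonempty (Fin d₁) with hempty | hne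
  · have hd₂ : d₂ = 0 := by
      have : d₁ = 0 := by
        rw [← Fintype.card_fin d₁, Fintype.card_eq_zero_iff]
        exact hempty
      omega
    subst hd₂
    simp [Subsingleton.elim x0 xstar]
  set F : ℝ := ∑ j, ‖A j‖ ^ 2 with hF
  have hFpos : 0 < F := sum_pos (fun j _ => by have := norm_pos_iff.mpr (hA j); positivity)
    univ_nonempty
  have hrows : ∑ j, ‖A j‖ ^ 2 / F = 1 := by rw [← sum_div, ← hF, div_self hFpos.ne']
  have hnoise : ∑ ℓ, q ℓ * ∑ j, e ℓ j ^ 2 ≤ C * (1 - q 0) := by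
    rw [← hq1, Fin.sum_univ_succ, Fin.sum_univ_succ, he0, add_sub_cancel_left]
    simp only [Pi.zero_apply, ne_eq, OfNat.ofNat_ne_zero, not_false_eq_true, zero_pow,
      sum_const_zero, mul_zero, zero_add]
    rw [mul_comm C, sum_mul]
    refine sum_le_sum fun ℓ _ => ?_
    exact mul_le_mul_of_nonneg_left (hC _ ℓ.succ_ne_zero) (hq _)
  have hα1 : 1 - σ ^ 2 / F ≠ 1 := by
    have : 0 < σ ^ 2 / F := by positivity
    linarith
  have key := sum_prod_mul_iterSeq_le
    (fun s : Fin d₁ × Fin (k + 1) => ‖A s.1‖ ^ 2 / F * q s.2)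
    (fun s => mul_nonneg (by positivity) (hq _))
    (by rw [Fintype.sum_prod_type]; simp only [← mul_sum, hq1, mul_one, hrows])
    (fun s y => y + ((b s.1 - ⟪A s.1, y⟫ + e s.2 s.1) / ‖A s.1‖ ^ 2) • A s.1)
    (fun y => ‖y - xstar‖ ^ 2) (B := C * (1 - q 0) / F) hα0 ?_ x0 (i + 1)
  · rwa [geom_sum_eq hα1, ← neg_div_neg_eq (_ ^ _ - 1), neg_sub, neg_sub] at key
  intro y
  have hterm (j : Fin d₁) (ℓ : Fin (k + 1)) :
      ‖A j‖ ^ 2 / F * q ℓ * ‖y + ((b j - ⟪A j, y⟫ + e ℓ j) / ‖A j‖ ^ 2) • A j - xstar‖ ^ 2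
        = q ℓ * (‖A j‖ ^ 2 / F * ‖y - xstar‖ ^ 2 - ⟪A j, y - xstar⟫ ^ 2 / F)
          + q ℓ * e ℓ j ^ 2 / F := by
    have hj : ‖A j‖ ≠ 0 := norm_ne_zero_iff.mpr (hA j)
    rw [← hsol, norm_sq_kaczmarz_step (hA j)]
    field_simp
    ring
  calc _ = ‖y - xstar‖ ^ 2 - (∑ j, ⟪A j, y - xstar⟫ ^ 2) / F
        + (∑ ℓ, q ℓ * ∑ j, e ℓ j ^ 2) / F := by
        simp only [Fintype.sum_prod_type, hterm, sum_add_distrib, ← sum_mul, hq1, one_mul,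
          sum_sub_distrib, hrows, ← sum_div]
        rw [sum_comm]
        simp only [mul_sum]
    _ ≤ ‖y - xstar‖ ^ 2 - (σ ^ 2 * ‖y - xstar‖ ^ 2) / F + C * (1 - q 0) / F := by
        gcongr
        exact hσ _
    _ = _ := by ring
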